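/- For two fermions on an even number N = 2K of modes, the set of decreasingly ordered spectra of the one-particle reduced density matrix of a pure state in Λ²(ℂ^N) (normalized to trace 2) is exactly {η ∈ ℝ^N : η₁ = η₂ ≥ η₃ = η₄ ≥ … ≥ η_{N−1} = η_N ≥ 0, Σᵢ ηᵢ = 2}, i.e. the eigenvalues come in equal pairs (evenness degeneracy) and are otherwise only constrained by ordering and normalization. -/

import Mathlib

open Matrix

theorem tf_forward {n : ℕ} (η : Fin n → ℝ) (hord : Antitone η)
    (D : Matrix (Fin n) (Fin n) ℂ) (hD : Dᵀ = -D)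
    (hDD : (2 : ℂ) • (D * Dᴴ) = Matrix.diagonal (fun i => (η i : ℂ))) (hpos : ∀ i, 0 ≤ η i)
    (k : ℕ) (hk : 2 * k + 1 < n) :
    η ⟨2 * k, by omega⟩ = η ⟨2 * k + 1, hk⟩ := by
  have hanti : ∀ i j, D j i = - D i j := fun i j => by
    have := congrFun (congrFun hD i) j
    simpa using this
  set L : Matrix (Fin n) (Fin n) ℂ := Matrix.diagonal (fun i => (η i : ℂ)) with hL
  have hconj : (2 : ℂ) • (Dᴴ * D) = L := by
    have h1 : ((2 : ℂ) • (D * Dᴴ))ᵀ = Lᵀ := by rw [hDD]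
    rw [hL, Matrix.diagonal_transpose, ← hL] at h1
    rw [← h1, Matrix.transpose_smul, Matrix.transpose_mul, hD]
    have h2 : Dᴴᵀ = -Dᴴ := by
      ext i j
      simp [hanti i j]
    rw [h2]; simp
  have hcomm : D * L = L * D := by
    rw [← hconj]
    rw [hconj, ← hDD] 
    nth_rewrite 1 [hDD]
    rw [← hconj]
    simp [Matrix.mul_assoc]
  by_contra hne
  have hlt : η ⟨2 * k + 1, hk⟩ < η ⟨2 * k, by omega⟩ :=
    lt_of_le_of_ne (hord (by simp [Fin.le_def])) (Ne.symm hne)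
  have hoff : ∀ i j : Fin n, η i ≠ η j → D i j = 0 := by
    intro i j hij
    have := congrFun (congrFun hcomm i) j
    rw [hL, Matrix.mul_diagonal, Matrix.diagonal_mul] at this
    have h3 : ((η j : ℂ) - η i) * D i j = 0 := by linear_combination this
    rcases mul_eq_zero.1 h3 with h | h
    · exact absurd (by exact_mod_cast (sub_eq_zero.1 h).symm) hij
    · exact h
  let e : Fin (2 * k + 1) → Fin n := Fin.castLE (by omega)
  have he : Function.Injective e := Fin.castLE_injective _
  have hbig : ∀ i, η ⟨2 * k + 1, hk⟩ < η (e i) := fun i =>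
    lt_of_lt_of_le hlt (hord (by have := i.2; simp [Fin.le_def, e]; omega))
  let M := D.submatrix e e
  have hM : (2 : ℂ) • (M * Mᴴ) = Matrix.diagonal (fun i => (η (e i) : ℂ)) := by
    ext i j
    have h4 := congrFun (congrFun hDD (e i)) (e j)
    have h5 : (M * Mᴴ) i j = (D * Dᴴ) (e i) (e j) := by
      rw [Matrix.mul_apply, Matrix.mul_apply]
      refine Fintype.sum_of_injective e he _ _ ?_ ?_
      · intro l hl
        have : D (e i) l = 0 := by
          apply hoff
          have hl2 : 2 * k + 1 ≤ (l : ℕ) := by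
            by_contra hcon
            exact hl ⟨⟨l, by omega⟩, by ext; simp [e]⟩
          exact ne_of_gt (lt_of_le_of_lt (hord (by simpa [Fin.le_def] using hl2)) (hbig i))
        simp [this]
      · intro l; simp [M]
    rw [Matrix.smul_apply, h5, ← Matrix.smul_apply, h4, hL, Matrix.diagonal_apply,
      Matrix.diagonal_apply]
    simp [he.eq_iff]
  have hdet : M.det = 0 := by
    have hMT : Mᵀ = -M := by
      ext i j
      simp [M, hanti (e i) (e j)]
    have h6 := congrArg Matrix.det hMT
    rw [Matrix.det_transpose, Matrix.det_neg, Fintype.card_fin,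
      Odd.neg_one_pow ⟨k, rfl⟩] at h6
    have : (2 : ℂ) * M.det = 0 := by linear_combination h6
    simpa using this
  have h7 := congrArg Matrix.det hM
  rw [Matrix.det_smul, Matrix.det_mul, hdet, Matrix.det_diagonal] at h7
  rw [zero_mul, mul_zero, eq_comm, Finset.prod_eq_zero_iff] at h7
  obtain ⟨i, -, hi⟩ := h7
  have h8 := hbig i
  have h9 := hpos ⟨2 * k + 1, hk⟩
  have : η (e i) = 0 := by exact_mod_cast hi
  linarith

def tfPartner (K : ℕ) (i : Fin (2 * K)) : Fin (2 * K) :=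
  ⟨if (i : ℕ) % 2 = 0 then (i : ℕ) + 1 else (i : ℕ) - 1, by have := i.2; split_ifs <;> omega⟩

theorem tfPartner_invol (K : ℕ) (i : Fin (2 * K)) : tfPartner K (tfPartner K i) = i := by
  ext
  simp only [tfPartner]
  split_ifs <;> omega

theorem tfPartner_eq (K : ℕ) (η : Fin (2 * K) → ℝ)
    (h : ∀ (k : ℕ) (h1 : 2 * k < 2 * K) (h2 : 2 * k + 1 < 2 * K), η ⟨2 * k, h1⟩ = η ⟨2 * k + 1, h2⟩)
    (i : Fin (2 * K)) : η (tfPartner K i) = η i := by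
  have hk := h ((i : ℕ) / 2) (by omega) (by omega)
  by_cases hi : (i : ℕ) % 2 = 0
  · have h1 : tfPartner K i = ⟨2 * ((i : ℕ) / 2) + 1, by omega⟩ := by
      ext; simp only [tfPartner]; split_ifs; omega
    have h2 : i = ⟨2 * ((i : ℕ) / 2), by omega⟩ := by
      ext; simp only; omega
    rw [h1, ← hk, ← h2]
  · have h1 : tfPartner K i = ⟨2 * ((i : ℕ) / 2), by omega⟩ := by
      ext; simp only [tfPartner]; split_ifs; omega
    have h2 : i = ⟨2 * ((i : ℕ) / 2) + 1, by omega⟩ := by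
      ext; simp only; omega
    rw [h1, hk, ← h2]

noncomputable def tfMat (K : ℕ) (η : Fin (2 * K) → ℝ) : Matrix (Fin (2 * K)) (Fin (2 * K)) ℂ :=
  fun i j => if j = tfPartner K i then (-1) ^ (i : ℕ) * (Real.sqrt (η i / 2) : ℂ) else 0

theorem tfMat_anti (K : ℕ) (η : Fin (2 * K) → ℝ)
    (h : ∀ (k : ℕ) (h1 : 2 * k < 2 * K) (h2 : 2 * k + 1 < 2 * K), η ⟨2 * k, h1⟩ = η ⟨2 * k + 1, h2⟩) :
    (tfMat K η)ᵀ = - tfMat K η := by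
  ext i j
  simp only [Matrix.transpose_apply, Matrix.neg_apply, tfMat]
  by_cases hj : j = tfPartner K i
  · have hs : ((-1 : ℂ)) ^ (tfPartner K i : ℕ) = - (-1) ^ (i : ℕ) := by
      simp only [tfPartner]
      split_ifs with hi
      · rw [pow_succ]; ring
      · obtain ⟨m, hm⟩ : ∃ m, (i : ℕ) = m + 1 := ⟨(i : ℕ) - 1, by omega⟩
        rw [hm, pow_succ]; simp
    subst hj
    rw [if_pos (tfPartner_invol K i).symm, if_pos rfl, tfPartner_eq K η h, hs]
    ring
  · rw [if_neg hj, if_neg]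
    · simp
    · intro h'
      exact hj (by rw [h', tfPartner_invol])

theorem tfMat_mul (K : ℕ) (η : Fin (2 * K) → ℝ) (hpos : ∀ i, 0 ≤ η i) :
    (2 : ℂ) • (tfMat K η * (tfMat K η)ᴴ) = Matrix.diagonal (fun i => (η i : ℂ)) := by
  ext i j
  rw [Matrix.smul_apply, Matrix.mul_apply, Matrix.diagonal_apply]
  rw [Finset.sum_eq_single (tfPartner K i)]
  · by_cases hij : i = j
    · subst hij
      have h1 : ((Real.sqrt (η i / 2) : ℂ)) * (Real.sqrt (η i / 2) : ℂ) = (η i : ℂ) / 2 := by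
        have := Real.mul_self_sqrt (div_nonneg (hpos i) (by norm_num : (0 : ℝ) ≤ 2))
        exact_mod_cast this
      have h2 : ((-1 : ℂ)) ^ (i : ℕ) * (-1) ^ (i : ℕ) = 1 := by
        rw [← mul_pow]; simp
      simp only [tfMat, Matrix.conjTranspose_apply, if_true, star_mul', star_pow, star_neg,
        star_one, smul_eq_mul]
      rw [show star (Real.sqrt (η i / 2) : ℂ) = (Real.sqrt (η i / 2) : ℂ) from Complex.conj_ofReal _]
      linear_combination (2 * (Real.sqrt (η i / 2) : ℂ) * (Real.sqrt (η i / 2) : ℂ)) * h2 + 2 * h1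
    · have : tfPartner K i ≠ tfPartner K j := fun h' => hij (by
        rw [← tfPartner_invol K i, h', tfPartner_invol])
      simp [tfMat, this, hij]
  · intro l _ hl
    simp [tfMat, hl]
  · simp

theorem two_fermions_spectral_polytope (K : ℕ)
    (η : Fin (2 * K) → ℝ) (hord : Antitone η) :
    (∃ C : Matrix (Fin (2 * K)) (Fin (2 * K)) ℂ,
      Cᵀ = -C ∧
      (Cᴴ * C).trace = 1 ∧
      ∃ U ∈ Matrix.unitaryGroup (Fin (2 * K)) ℂ,
        (2 : ℂ) • (C * Cᴴ) = U * Matrix.diagonal (fun i => (η i : ℂ)) * star U) ↔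
    ((∀ k : Fin K, η ⟨2 * (k : ℕ), by omega⟩ = η ⟨2 * (k : ℕ) + 1, by omega⟩) ∧
      (∀ i, 0 ≤ η i) ∧ (∑ i, η i = 2)) := by
  constructor
  · rintro ⟨C, hC, htr, U, hU, hCU⟩
    have hUU : star U * U = 1 := Matrix.mem_unitaryGroup_iff'.1 hU
    have hUU' : U * star U = 1 := Matrix.mem_unitaryGroup_iff.1 hU
    set D : Matrix (Fin (2 * K)) (Fin (2 * K)) ℂ := star U * C * (star U)ᵀ with hDdef
    have hD : Dᵀ = -D := by
      simp only [hDdef, Matrix.transpose_mul, Matrix.transpose_transpose, hC]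
      simp [Matrix.mul_assoc]
    have hT : (star U)ᵀ * ((star U)ᵀ)ᴴ = 1 := by
      have : ((star U)ᵀ)ᴴ = Uᵀ := by
        ext i j; simp [Matrix.star_apply]
      rw [this, ← Matrix.transpose_mul, hUU', Matrix.transpose_one]
    have hDD : (2 : ℂ) • (D * Dᴴ) = Matrix.diagonal (fun i => (η i : ℂ)) := by
      have h1 : D * Dᴴ = star U * (C * Cᴴ) * U := by
        rw [hDdef, Matrix.conjTranspose_mul, Matrix.conjTranspose_mul,
          show (star U)ᴴ = U from star_star U]
        calc _ = star U * C * ((star U)ᵀ * ((star U)ᵀ)ᴴ) * (Cᴴ * U) := by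
              simp only [Matrix.mul_assoc]
          _ = _ := by rw [hT]; simp only [Matrix.mul_assoc, Matrix.one_mul]
      rw [h1, ← Matrix.smul_mul, ← Matrix.mul_smul, hCU]
      calc _ = (star U * U) * Matrix.diagonal (fun i => (η i : ℂ)) * (star U * U) := by
            simp only [Matrix.mul_assoc]
        _ = _ := by rw [hUU]; simp
    have hpos : ∀ i, 0 ≤ η i := by
      intro i
      have h2 := congrFun (congrFun hDD i) i
      rw [Matrix.diagonal_apply_eq, Matrix.smul_apply, Matrix.mul_apply] at h2
      have h3 : (2 : ℂ) • ∑ j, D i j * Dᴴ j i = ((2 * ∑ j, Complex.normSq (D i j) : ℝ) : ℂ) := by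
        push_cast
        simp only [smul_eq_mul, Matrix.conjTranspose_apply]
        congr 1
        exact Finset.sum_congr rfl fun j _ => Complex.mul_conj _
      rw [h3] at h2
      have h4 : 2 * ∑ j, Complex.normSq (D i j) = η i := by exact_mod_cast h2
      rw [← h4]
      exact mul_nonneg (by norm_num) (Finset.sum_nonneg fun j _ => Complex.normSq_nonneg _)
    refine ⟨fun k => tf_forward η hord D hD hDD hpos k (by omega), hpos, ?_⟩
    have h5 := congrArg Matrix.trace hCU
    rw [Matrix.trace_smul, Matrix.trace_mul_comm, htr, Matrix.trace_mul_comm, ← Matrix.mul_assoc,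
      hUU, Matrix.one_mul, Matrix.trace_diagonal] at h5
    have h6 : (2 : ℂ) = ((∑ i, η i : ℝ) : ℂ) := by push_cast; simpa using h5
    exact_mod_cast h6.symm
  · rintro ⟨h, hpos, hsum⟩
    refine ⟨tfMat K η, tfMat_anti K η (fun k h1 _ => h ⟨k, by omega⟩), ?_, 1, one_mem _, ?_⟩
    · have h5 := congrArg Matrix.trace (tfMat_mul K η hpos)
      rw [Matrix.trace_smul, Matrix.trace_mul_comm, Matrix.trace_diagonal] at h5
      have h6 : ∑ i, (η i : ℂ) = 2 := by exact_mod_cast hsum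
      rw [h6, smul_eq_mul] at h5
      linear_combination h5 / 2
    · rw [tfMat_mul K η hpos]; simp
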